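/- There exists a constant C > 0 such that the following holds. Let M, k ∈ ℕ with M ≥ 2, k ≥ 1, let A ⊆ {0,…,M−1} be nonempty, and let α ∈ ℚ with 1 ≤ α < M be such that N = α·M^k ∈ ℕ. Then ‖𝟙_{C_k(N)} F_N 𝟙_{C_k(N)}‖² ≤ α·C·G^k, where G = (|A|/M)·sup_{x∈ℝ} Σ_{a∈A} sup{ |F_1(t)| : t ∈ x + α·a/M + [0, α·(max A + 1)/M²] } and F_1(x) = |A|^{−1} Σ_{a∈A} e^{−2πi·a·x}. -/

import Mathlib

open scoped Classical

noncomputable section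

/-- `e^{-2πi x}` -/
def ec (x : ℝ) : ℂ := Complex.exp (-(2 * Real.pi * x) * Complex.I)

/-- The discrete Fourier transform matrix `F_N`, with entries `N^{-1/2} e^{-2πi jl/N}`. -/
def dftMatrix (N : ℕ) : Matrix (Fin N) (Fin N) ℂ :=
  Matrix.of fun j l : Fin N => ((Real.sqrt N)⁻¹ : ℝ) * ec ((j : ℕ) * (l : ℕ) / (N : ℝ))

/-- Multiplication by the indicator function of `S`, as a matrix on `ℂ^N`. -/
def indicatorMatrix (N : ℕ) (S : Finset ℕ) : Matrix (Fin N) (Fin N) ℂ :=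
  Matrix.diagonal fun j => if (j : ℕ) ∈ S then 1 else 0

/-- The discrete Cantor set `C_k = {a₀ + a₁ M + ⋯ + a_{k-1} M^{k-1} : a_j ∈ A}`. -/
def cantorC (M k : ℕ) (A : Finset ℕ) : Finset ℕ :=
  (Fintype.piFinset fun _ : Fin k => A).image fun a => ∑ j : Fin k, a j * M ^ (j : ℕ)

/-- The operator norm of a matrix acting on `ℂ^N` with the ℓ² norm. -/
def opNorm {N : ℕ} (A : Matrix (Fin N) (Fin N) ℂ) : ℝ :=
  ‖Matrix.toEuclideanCLM (𝕜 := ℂ) A‖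

/-- The normalized exponential sum `F_1(x) = |A|⁻¹ Σ_{a ∈ A} e^{-2πi a x}`. -/
def F1 (A : Finset ℕ) (x : ℝ) : ℂ := (A.card : ℂ)⁻¹ * ∑ a ∈ A, ec ((a : ℝ) * x)

/-- `G = (|A|/M) sup_{x ∈ ℝ} Σ_{a ∈ A} sup { |F_1(t)| : t ∈ x + αa/M + [0, α(max A + 1)/M²] }`. -/
def Gquant (M : ℕ) (A : Finset ℕ) (α : ℚ) : ℝ :=
  ((A.card : ℝ) / (M : ℝ)) *
    sSup (Set.range fun x : ℝ => ∑ a ∈ A,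
      sSup ((fun t => ‖F1 A t‖) ''
        Set.Icc (x + (α : ℝ) * (a : ℝ) / (M : ℝ))
          (x + (α : ℝ) * (a : ℝ) / (M : ℝ) + (α : ℝ) * ((A.sup id : ℕ) + 1) / (M : ℝ) ^ 2)))

/-- The dilated discrete Cantor set `C_k(N) = { ⌈α j⌉ : j ∈ C_k }`. -/
def cantorCdil (M k : ℕ) (A : Finset ℕ) (α : ℚ) : Finset ℕ :=
  (cantorC M k A).image fun j => (⌈α * (j : ℚ)⌉).toNat

open scoped Matrix.Norms.L2Operator

lemma ec_add (x y : ℝ) : ec (x + y) = ec x * ec y := by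
  unfold ec; rw [← Complex.exp_add]; congr 1; push_cast; ring

lemma norm_ec (x : ℝ) : ‖ec x‖ = 1 := by
  unfold ec
  have := Complex.norm_exp_ofReal_mul_I (-(2 * Real.pi * x))
  push_cast at this
  exact this

lemma conj_ec (x : ℝ) : star (ec x) = ec (-x) := by
  unfold ec
  rw [Complex.star_def, ← Complex.exp_conj]; congr 1
  simp only [map_mul, map_neg, Complex.conj_I, Complex.conj_ofReal, map_ofNat]
  push_cast; ring

lemma ec_sum {ι : Type*} (s : Finset ι) (f : ι → ℝ) : ec (∑ i ∈ s, f i) = ∏ i ∈ s, ec (f i) := by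
  induction s using Finset.induction_on with
  | empty => simp [ec]
  | insert a s ha ih => rw [Finset.sum_insert ha, Finset.prod_insert ha, ec_add, ih]

lemma norm_F1_neg (A : Finset ℕ) (x : ℝ) : ‖F1 A (-x)‖ = ‖F1 A x‖ := by
  have : F1 A (-x) = star (F1 A x) := by
    unfold F1
    simp only [star_mul', star_sum, conj_ec]
    simp
  rw [this, norm_star]

lemma norm_F1_le (A : Finset ℕ) (x : ℝ) : ‖F1 A x‖ ≤ 1 := by
  unfold F1
  rw [norm_mul, norm_inv, Complex.norm_natCast]
  have : ‖∑ a ∈ A, ec ((a : ℝ) * x)‖ ≤ A.card := by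
    refine (norm_sum_le _ _).trans ?_
    simp [norm_ec]
  exact inv_mul_le_one_of_le₀ this (by positivity)

/-- Multiplying a kernel by `ec (p j * q l)` costs at most `exp (2π)`. -/
lemma norm_phase {ι : Type*} [Fintype ι] [DecidableEq ι] (K : Matrix ι ι ℂ) (p q : ι → ℝ)
    (hp : ∀ i, |p i| ≤ 1) (hq : ∀ i, |q i| ≤ 1) :
    ‖(Matrix.of fun j l => K j l * ec (p j * q l) : Matrix ι ι ℂ)‖ ≤ Real.exp (2 * Real.pi) * ‖K‖ := by
  set c : ℂ := -(2 * Real.pi) * Complex.I with hc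
  have hcn : ‖c‖ = 2 * Real.pi := by
    rw [hc]; simp [abs_of_pos Real.pi_pos]
  let T : ℕ → Matrix ι ι ℂ := fun n => (c ^ n / (n.factorial : ℂ)) •
    (Matrix.diagonal (fun j => (p j : ℂ) ^ n) * K * Matrix.diagonal (fun l => (q l : ℂ) ^ n))
  have hT : HasSum T (Matrix.of fun j l => K j l * ec (p j * q l) : Matrix ι ι ℂ) := by
    refine Pi.hasSum.2 fun j => Pi.hasSum.2 fun l => ?_
    have h1 := NormedSpace.expSeries_div_hasSum_exp (c * (p j * q l))
    have h2 := h1.mul_left (K j l)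
    rw [← Complex.exp_eq_exp_ℂ] at h2
    have e1 : (fun n => T n j l) =
        fun i => K j l * ((c * (↑(p j) * ↑(q l))) ^ i / (i.factorial : ℂ)) := by
      funext n
      simp only [T, Matrix.smul_apply, Matrix.mul_diagonal, Matrix.diagonal_mul, smul_eq_mul]
      ring
    have e2 : (Matrix.of fun j l => K j l * ec (p j * q l) : Matrix ι ι ℂ) j l =
        K j l * Complex.exp (c * (↑(p j) * ↑(q l))) := by
      simp only [Matrix.of_apply, ec, hc]
      push_cast
      congr 2
      ring
    rw [e2]
    exact e1 ▸ h2
  have hd : ∀ (r : ι → ℝ) (n : ℕ), (∀ i, |r i| ≤ 1) →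
      ‖(Matrix.diagonal (fun j => (r j : ℂ) ^ n) : Matrix ι ι ℂ)‖ ≤ 1 := by
    intro r n hr
    rw [Matrix.l2_opNorm_diagonal]
    refine (pi_norm_le_iff_of_nonneg zero_le_one).2 fun i => ?_
    rw [norm_pow, Complex.norm_real]
    exact pow_le_one₀ (norm_nonneg _) (hr i)
  have hs : HasSum (fun n : ℕ => (2 * Real.pi) ^ n / (n.factorial : ℝ) * ‖K‖)
      (Real.exp (2 * Real.pi) * ‖K‖) := by
    have := NormedSpace.expSeries_div_hasSum_exp (2 * Real.pi)
    rw [← Real.exp_eq_exp_ℝ] at this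
    exact this.mul_right _
  refine hT.norm_le_of_bounded hs fun n => ?_
  simp only [T]
  rw [norm_smul, norm_div, norm_pow, hcn, Complex.norm_natCast]
  refine mul_le_mul_of_nonneg_left ?_ (by positivity)
  calc _ ≤ ‖(Matrix.diagonal (fun j => (p j : ℂ) ^ n) : Matrix ι ι ℂ)‖ * ‖K‖ *
        ‖(Matrix.diagonal (fun j => (q j : ℂ) ^ n) : Matrix ι ι ℂ)‖ := by
        refine (Matrix.l2_opNorm_mul _ _).trans ?_
        gcongr
        exact Matrix.l2_opNorm_mul _ _
    _ ≤ 1 * ‖K‖ * 1 := by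
        gcongr
        · exact hd p n hp
        · exact hd q n hq
    _ = ‖K‖ := by ring

/-- Schur test for kernels with symmetric modulus. -/
lemma schur {ι : Type*} [Fintype ι] [DecidableEq ι] (H : Matrix ι ι ℂ) (R : ℝ) (hR : 0 ≤ R)
    (hsym : ∀ j l, ‖H j l‖ = ‖H l j‖) (hrow : ∀ j, ∑ l, ‖H j l‖ ≤ R) : ‖H‖ ≤ R := by
  rw [Matrix.l2_opNorm_def]
  refine ContinuousLinearMap.opNorm_le_bound _ hR fun w => ?_
  refine le_of_sq_le_sq ?_ (by positivity)
  rw [mul_pow, EuclideanSpace.norm_sq_eq, EuclideanSpace.norm_sq_eq]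
  have key : ∀ j, ‖∑ l, H j l * w l‖ ^ 2 ≤ R * ∑ l, ‖H j l‖ * ‖w l‖ ^ 2 := by
    intro j
    have h1 : ‖∑ l, H j l * w l‖ ≤ ∑ l, ‖H j l‖ * ‖w l‖ :=
      (norm_sum_le _ _).trans (by simp)
    have h2 : (∑ l, ‖H j l‖ * ‖w l‖) ^ 2 ≤ (∑ l, ‖H j l‖) * ∑ l, ‖H j l‖ * ‖w l‖ ^ 2 := by
      refine Finset.sum_sq_le_sum_mul_sum_of_sq_le_mul _ (fun _ _ => norm_nonneg _)
        (fun _ _ => by positivity) fun i _ => le_of_eq (by ring)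
    calc _ ≤ (∑ l, ‖H j l‖ * ‖w l‖) ^ 2 := by gcongr
      _ ≤ _ := h2
      _ ≤ _ := by
        refine mul_le_mul_of_nonneg_right (hrow j) ?_
        positivity
  calc _ = ∑ j, ‖∑ l, H j l * w l‖ ^ 2 := by
        simp [Matrix.mulVec, dotProduct]
    _ ≤ ∑ j, R * ∑ l, ‖H j l‖ * ‖w l‖ ^ 2 := Finset.sum_le_sum fun j _ => key j
    _ = R * ∑ l, (∑ j, ‖H l j‖) * ‖w l‖ ^ 2 := by
        rw [← Finset.mul_sum, Finset.sum_comm]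
        congr 1
        refine Finset.sum_congr rfl fun l _ => ?_
        rw [Finset.sum_mul]
        exact Finset.sum_congr rfl fun j _ => by rw [hsym]
    _ ≤ R * ∑ l, R * ‖w l‖ ^ 2 := by
        gcongr with l _
        exact hrow l
    _ = _ := by rw [← Finset.mul_sum]; ring

/-- The value of a digit string. -/
def dval (M : ℕ) {A : Finset ℕ} {k : ℕ} (a : Fin k → A) : ℕ := ∑ j : Fin k, (a j : ℕ) * M ^ (j : ℕ)

lemma dval_snoc (M : ℕ) {A : Finset ℕ} {k : ℕ} (a : Fin (k + 1) → A) :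
    dval M a = dval M (fun i : Fin k => a i.castSucc) + (a (Fin.last k) : ℕ) * M ^ k := by
  simp [dval, Fin.sum_univ_castSucc]

lemma dval_cons (M : ℕ) {A : Finset ℕ} {k : ℕ} (a : Fin (k + 1) → A) :
    dval M a = a 0 + M * dval M (fun i : Fin k => a i.succ) := by
  simp only [dval, Fin.sum_univ_succ, Finset.mul_sum]
  simp [pow_succ]
  exact Finset.sum_congr rfl fun j _ => by ring

lemma dval_lt {M : ℕ} (hM : 2 ≤ M) {A : Finset ℕ} (hA : A ⊆ Finset.range M) {k : ℕ}
    (a : Fin k → A) : dval M a < M ^ k := by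
  induction k with
  | zero => simp [dval]
  | succ k ih =>
    rw [dval_snoc]
    have h1 := ih (fun i : Fin k => a i.castSucc)
    have h2 : (a (Fin.last k) : ℕ) + 1 ≤ M := Finset.mem_range.1 (hA (a (Fin.last k)).2)
    calc _ < M ^ k + (a (Fin.last k) : ℕ) * M ^ k := by omega
      _ = ((a (Fin.last k) : ℕ) + 1) * M ^ k := by ring
      _ ≤ M * M ^ k := by gcongr
      _ = _ := by ring

lemma dval_inj {M : ℕ} {A : Finset ℕ} (hA : A ⊆ Finset.range M) {k : ℕ} :
    Function.Injective (dval M : (Fin k → A) → ℕ) := by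
  induction k with
  | zero => intro a b _; exact Subsingleton.elim _ _
  | succ k ih =>
    intro a b h
    rw [dval_cons, dval_cons] at h
    have ha : (a 0 : ℕ) < M := Finset.mem_range.1 (hA (a 0).2)
    have hb : (b 0 : ℕ) < M := Finset.mem_range.1 (hA (b 0).2)
    have h0 : (a 0 : ℕ) = b 0 := by
      have := congrArg (· % M) h
      simpa [Nat.mod_eq_of_lt ha, Nat.mod_eq_of_lt hb] using this
    have h1 : dval M (fun i : Fin k => a i.succ) = dval M (fun i : Fin k => b i.succ) := by
      rw [h0] at h
      exact Nat.eq_of_mul_eq_mul_left (by omega) (Nat.add_left_cancel h)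
    have h2 := ih h1
    funext i
    refine Fin.cases (Subtype.ext h0) (fun i => congrFun h2 i) i

/-- Lower digits fit in the window. -/
lemma dval_window {M : ℕ} (hM : 2 ≤ M) {A : Finset ℕ} (hA : A ⊆ Finset.range M) {k : ℕ}
    (a : Fin k → A) : M * dval M a ≤ (A.sup id + 1) * M ^ k := by
  cases k with
  | zero => simp [dval]
  | succ k =>
    rw [dval_snoc]
    have h1 := dval_lt hM hA (fun i : Fin k => a i.castSucc)
    have h2 : (a (Fin.last k) : ℕ) ≤ A.sup id := Finset.le_sup (f := id) (a (Fin.last k)).2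
    calc _ ≤ M * (M ^ k + (A.sup id) * M ^ k) := by gcongr
      _ = _ := by ring

/-- window supremum -/
def Wsup (M : ℕ) (A : Finset ℕ) (α : ℚ) (x : ℝ) (a : ℕ) : ℝ :=
  sSup ((fun t => ‖F1 A t‖) ''
        Set.Icc (x + (α : ℝ) * (a : ℝ) / (M : ℝ))
          (x + (α : ℝ) * (a : ℝ) / (M : ℝ) + (α : ℝ) * ((A.sup id : ℕ) + 1) / (M : ℝ) ^ 2))

def Ssup (M : ℕ) (A : Finset ℕ) (α : ℚ) : ℝ :=
  sSup (Set.range fun x : ℝ => ∑ a ∈ A, Wsup M A α x a)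

lemma Gquant_eq (M : ℕ) (A : Finset ℕ) (α : ℚ) :
    Gquant M A α = ((A.card : ℝ) / (M : ℝ)) * Ssup M A α := rfl

lemma Wsup_nonneg (M : ℕ) (A : Finset ℕ) (α : ℚ) (x : ℝ) (a : ℕ) : 0 ≤ Wsup M A α x a := by
  apply Real.sSup_nonneg
  rintro _ ⟨t, _, rfl⟩
  exact norm_nonneg _

lemma Wsup_le (M : ℕ) (A : Finset ℕ) (α : ℚ) (x : ℝ) (a : ℕ) : Wsup M A α x a ≤ 1 := by
  apply Real.sSup_le _ zero_le_one
  rintro _ ⟨t, _, rfl⟩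
  exact norm_F1_le _ _

lemma sum_Wsup_le (M : ℕ) (A : Finset ℕ) (α : ℚ) (x : ℝ) :
    ∑ a ∈ A, Wsup M A α x a ≤ Ssup M A α := by
  refine le_csSup ⟨A.card, ?_⟩ ⟨x, rfl⟩
  rintro _ ⟨y, rfl⟩
  refine (Finset.sum_le_sum fun a _ => Wsup_le M A α y a).trans ?_
  simp

lemma Ssup_nonneg (M : ℕ) (A : Finset ℕ) (α : ℚ) : 0 ≤ Ssup M A α := by
  apply Real.sSup_nonneg
  rintro _ ⟨y, rfl⟩
  exact Finset.sum_nonneg fun a _ => Wsup_nonneg _ _ _ _ _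

lemma le_Wsup {M : ℕ} {A : Finset ℕ} {α : ℚ} {x : ℝ} {a : ℕ} {t : ℝ}
    (h1 : x + (α : ℝ) * (a : ℝ) / (M : ℝ) ≤ t)
    (h2 : t ≤ x + (α : ℝ) * (a : ℝ) / (M : ℝ) + (α : ℝ) * ((A.sup id : ℕ) + 1) / (M : ℝ) ^ 2) :
    ‖F1 A t‖ ≤ Wsup M A α x a := by
  refine le_csSup ⟨1, ?_⟩ ⟨t, ⟨h1, h2⟩, rfl⟩
  rintro _ ⟨y, _, rfl⟩
  exact norm_F1_le _ _

lemma row_sum {M : ℕ} (hM : 2 ≤ M) {A : Finset ℕ} (hA : A ⊆ Finset.range M) {α : ℚ}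
    (hα : 1 ≤ α) (k : ℕ) (z : ℝ) :
    ∑ a : Fin k → A, ∏ i : Fin k, ‖F1 A ((α : ℝ) * ((dval M a : ℝ) - z) / (M : ℝ) ^ ((i : ℕ) + 1))‖
      ≤ Ssup M A α ^ k := by
  have hαR : (1 : ℝ) ≤ (α : ℝ) := by exact_mod_cast hα
  have hM0 : (0 : ℝ) < M := by
    have : 0 < M := by omega
    exact_mod_cast this
  induction k generalizing z with
  | zero => simp
  | succ k ih =>
    rw [← (Fin.snocEquiv (fun _ : Fin (k + 1) => (A : Type))).sum_comp, Fintype.sum_prod_type]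
    have hstep : ∀ (d : A) (b : Fin k → A),
        ∏ i : Fin (k + 1), ‖F1 A ((α : ℝ) * ((dval M (Fin.snocEquiv (fun _ : Fin (k + 1) => (A : Type)) (d, b)) : ℝ) - z) / (M : ℝ) ^ ((i : ℕ) + 1))‖
        ≤ Wsup M A α (-(α * z) / (M : ℝ) ^ (k + 1)) d *
          ∏ i : Fin k, ‖F1 A ((α : ℝ) * ((dval M b : ℝ) - (z - d * (M : ℝ) ^ k)) / (M : ℝ) ^ ((i : ℕ) + 1))‖ := by
      intro d b
      have hv : (dval M (Fin.snocEquiv (fun _ : Fin (k + 1) => (A : Type)) (d, b)) : ℝ)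
          = dval M b + d * (M : ℝ) ^ k := by
        rw [dval_snoc]
        simp [Fin.snocEquiv]
      rw [Fin.prod_univ_castSucc, mul_comm, hv]
      have e : ∀ i : ℕ, (α : ℝ) * ((dval M b : ℝ) + d * (M : ℝ) ^ k - z) / (M : ℝ) ^ (i + 1)
        = (α : ℝ) * ((dval M b : ℝ) - (z - d * (M : ℝ) ^ k)) / (M : ℝ) ^ (i + 1) := by
        intro i; ring
      refine mul_le_mul ?_ ?_ ?_ (Wsup_nonneg _ _ _ _ _)
      · have e2 : (α : ℝ) * ((dval M b : ℝ) + d * (M : ℝ) ^ k - z) / (M : ℝ) ^ (k + 1)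
            = -(α * z) / (M : ℝ) ^ (k + 1) + α * (d : ℕ) / M + α * dval M b / (M : ℝ) ^ (k + 1) := by
          field_simp
          ring
        have hw : (M : ℝ) * dval M b ≤ ((A.sup id : ℕ) + 1) * (M : ℝ) ^ k := by
          exact_mod_cast dval_window hM hA b
        rw [Fin.val_last, e2]
        apply le_Wsup
        · have : 0 ≤ (α : ℝ) * dval M b / (M : ℝ) ^ (k + 1) := by positivity
          linarith
        · refine add_le_add le_rfl ?_
          rw [div_le_div_iff₀ (by positivity) (by positivity)]
          calc (α : ℝ) * dval M b * (M : ℝ) ^ 2 = α * M * (M * dval M b) := by ring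
            _ ≤ α * M * (((A.sup id : ℕ) + 1) * (M : ℝ) ^ k) := by gcongr
            _ = _ := by ring
      · exact le_of_eq (Finset.prod_congr rfl fun i _ => by rw [← e]; rfl)
      · positivity
    calc _ ≤ ∑ d : A, ∑ b : Fin k → A, _ :=
          Finset.sum_le_sum fun d _ => Finset.sum_le_sum fun b _ => hstep d b
      _ ≤ ∑ d : A, Wsup M A α (-(α * z) / (M : ℝ) ^ (k + 1)) d * Ssup M A α ^ k := by
          refine Finset.sum_le_sum fun d _ => ?_
          rw [← Finset.mul_sum]
          exact mul_le_mul_of_nonneg_left (ih _) (Wsup_nonneg _ _ _ _ _)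
      _ = (∑ d ∈ A, Wsup M A α (-(α * z) / (M : ℝ) ^ (k + 1)) d) * Ssup M A α ^ k := by
          rw [← Finset.sum_mul, Finset.sum_coe_sort A (fun d => Wsup M A α (-(α * z) / (M : ℝ) ^ (k + 1)) d)]
      _ ≤ Ssup M A α * Ssup M A α ^ k :=
          mul_le_mul_of_nonneg_right (sum_Wsup_le _ _ _ _) (pow_nonneg (Ssup_nonneg _ _ _) _)
      _ = _ := by ring

/-- The unrounded kernel. -/
def Kmat (M k : ℕ) (A : Finset ℕ) (α : ℚ) : Matrix (Fin k → A) (Fin k → A) ℂ :=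
  Matrix.of fun a b => ec ((α : ℝ) * dval M a * dval M b / (M : ℝ) ^ k)

lemma KK_apply {M : ℕ} (hM : 2 ≤ M) (k : ℕ) {A : Finset ℕ} (hne : A.Nonempty) (α : ℚ)
    (a b : Fin k → A) :
    ‖(Kmat M k A α * (Kmat M k A α).conjTranspose) a b‖ = (A.card : ℝ) ^ k *
      ∏ i : Fin k, ‖F1 A ((α : ℝ) * ((dval M b : ℝ) - dval M a) / (M : ℝ) ^ ((i : ℕ) + 1))‖ := by
  have hM0 : (M : ℝ) ≠ 0 := by
    have : M ≠ 0 := by omega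
    exact_mod_cast this
  have hc : (A.card : ℂ) ≠ 0 := by exact_mod_cast hne.card_pos.ne'
  set y : ℝ := (α : ℝ) * ((dval M b : ℝ) - dval M a) with hy
  have h1 : (Kmat M k A α * (Kmat M k A α).conjTranspose) a b
      = ∑ c : Fin k → A, ∏ i : Fin k, ec ((c i : ℕ) * (-(y * (M : ℝ) ^ (i : ℕ) / (M : ℝ) ^ k))) := by
    rw [Matrix.mul_apply]
    refine Finset.sum_congr rfl fun c _ => ?_
    rw [← ec_sum, Matrix.conjTranspose_apply, Kmat, Matrix.of_apply, Matrix.of_apply, conj_ec,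
      ← ec_add]
    congr 1
    have : ((dval M c : ℕ) : ℝ) = ∑ i : Fin k, ((c i : ℕ) : ℝ) * (M : ℝ) ^ (i : ℕ) := by
      simp [dval]
    calc _ = (-(y / (M : ℝ) ^ k)) * (dval M c : ℝ) := by rw [hy]; ring
      _ = _ := by
        rw [this, Finset.mul_sum]
        exact Finset.sum_congr rfl fun i _ => by ring
  have h2 : ∀ x : ℝ, ∑ d : A, ec ((d : ℕ) * x) = A.card * F1 A x := by
    intro x
    rw [F1, mul_inv_cancel_left₀ hc, Finset.sum_coe_sort A (fun d => ec ((d : ℝ) * x))]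
  have h3 : (Kmat M k A α * (Kmat M k A α).conjTranspose) a b
      = ∏ i : Fin k, ((A.card : ℂ) * F1 A (-(y * (M : ℝ) ^ (i : ℕ) / (M : ℝ) ^ k))) := by
    rw [h1, ← Fintype.prod_sum (fun (i : Fin k) (d : A) => ec ((d : ℕ) * (-(y * (M : ℝ) ^ (i : ℕ) / (M : ℝ) ^ k))))]
    exact Finset.prod_congr rfl fun i _ => h2 _
  rw [h3, norm_prod]
  simp only [norm_mul, Complex.norm_natCast, norm_F1_neg]
  rw [Finset.prod_mul_distrib]
  simp only [Finset.prod_const, Finset.card_univ, Fintype.card_fin]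
  congr 1
  rw [← Equiv.prod_comp Fin.revPerm]
  refine Finset.prod_congr rfl fun i _ => ?_
  congr 2
  have hi : k = (Fin.rev i : ℕ) + ((i : ℕ) + 1) := by
    rw [Fin.val_rev]; omega
  have : (M : ℝ) ^ k = (M : ℝ) ^ (Fin.rev i : ℕ) * (M : ℝ) ^ ((i : ℕ) + 1) := by
    rw [← pow_add, ← hi]
  rw [Fin.revPerm_apply, this]
  field_simp

lemma norm_Kmat {M : ℕ} (hM : 2 ≤ M) (k : ℕ) {A : Finset ℕ} (hA : A ⊆ Finset.range M)
    (hne : A.Nonempty) {α : ℚ} (hα : 1 ≤ α) :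
    ‖Kmat M k A α‖ ^ 2 ≤ (A.card : ℝ) ^ k * Ssup M A α ^ k := by
  have h : ‖Kmat M k A α * (Kmat M k A α).conjTranspose‖ = ‖Kmat M k A α‖ * ‖Kmat M k A α‖ := by
    have := Matrix.l2_opNorm_conjTranspose_mul_self (Kmat M k A α).conjTranspose
    rwa [Matrix.conjTranspose_conjTranspose, Matrix.l2_opNorm_conjTranspose] at this
  rw [sq, ← h]
  have hS := Ssup_nonneg M A α
  refine schur _ _ (by positivity) ?_ ?_
  · intro a b
    rw [KK_apply hM k hne, KK_apply hM k hne]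
    congr 1
    refine Finset.prod_congr rfl fun i _ => ?_
    rw [← norm_F1_neg]
    congr 2
    ring
  · intro a
    simp only [KK_apply hM k hne]
    rw [← Finset.mul_sum]
    exact mul_le_mul_of_nonneg_left (row_sum hM hA hα k _) (by positivity)

/-- Compression to an injectively parametrised subset. -/
lemma opNorm_compress {N : ℕ} {ι : Type*} [Fintype ι] [DecidableEq ι] (f : ι → Fin N)
    (hf : Function.Injective f) (S : Finset ℕ) (hS : ∀ x : Fin N, (x : ℕ) ∈ S ↔ ∃ i, f i = x)
    (F : Matrix (Fin N) (Fin N) ℂ) :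
    opNorm (indicatorMatrix N S * F * indicatorMatrix N S) ≤ ‖F.submatrix f f‖ := by
  set P : Matrix (Fin N) ι ℂ := Matrix.of fun x i => if f i = x then 1 else 0 with hP
  have hPP : P.conjTranspose * P = 1 := by
    ext i j
    rw [Matrix.mul_apply]
    simp [hP, Matrix.one_apply, hf.eq_iff, eq_comm]
  have hD : indicatorMatrix N S = P * P.conjTranspose := by
    ext x y
    rw [Matrix.mul_apply, indicatorMatrix, Matrix.diagonal_apply]
    by_cases hx : (x : ℕ) ∈ S
    · obtain ⟨i, rfl⟩ := (hS x).1 hx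
      simp only [hP, hx, if_true, Matrix.of_apply, Matrix.conjTranspose_apply, hf.eq_iff]
      rw [Finset.sum_eq_single i]
      · by_cases h : f i = y <;> simp [h]
      · intro b _ hb
        simp [hb]
      · simp
    · have : ∀ i, f i ≠ x := fun i h => hx ((hS x).2 ⟨i, h⟩)
      simp [hP, hx, this]
  have hF : P.conjTranspose * F * P = F.submatrix f f := by
    ext i j
    simp [Matrix.mul_apply, hP]
  have hPn : ‖P‖ ≤ 1 := by
    have h1 := Matrix.l2_opNorm_conjTranspose_mul_self P
    rw [hPP, ← Matrix.diagonal_one, Matrix.l2_opNorm_diagonal] at h1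
    have h2 : ‖(fun _ => 1 : ι → ℂ)‖ ≤ 1 :=
      (pi_norm_le_iff_of_nonneg zero_le_one).2 fun i => by simp
    have h3 : ‖P‖ * ‖P‖ ≤ 1 := h1 ▸ h2
    nlinarith [norm_nonneg P]
  have e : indicatorMatrix N S * F * indicatorMatrix N S
      = P * (F.submatrix f f) * P.conjTranspose := by
    rw [hD, ← hF]; simp only [Matrix.mul_assoc]
  have : opNorm (indicatorMatrix N S * F * indicatorMatrix N S)
      = ‖indicatorMatrix N S * F * indicatorMatrix N S‖ := by
    rw [opNorm, Matrix.l2_opNorm_def]; rfl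
  rw [this, e]
  calc _ ≤ ‖P‖ * ‖F.submatrix f f‖ * ‖P.conjTranspose‖ := by
        refine (Matrix.l2_opNorm_mul _ _).trans ?_
        gcongr
        exact Matrix.l2_opNorm_mul _ _
    _ ≤ 1 * ‖F.submatrix f f‖ * 1 := by
        rw [Matrix.l2_opNorm_conjTranspose]
        gcongr
    _ = _ := by ring

lemma mem_cantorCdil (M k : ℕ) (A : Finset ℕ) (α : ℚ) (x : ℕ) :
    x ∈ cantorCdil M k A α ↔ ∃ n ∈ cantorC M k A, (⌈α * (n : ℚ)⌉).toNat = x := by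
  simp only [cantorCdil, Finset.mem_image, Finset.bind_def, Finset.pure_def, Finset.mem_sup,
    Finset.mem_singleton]
  constructor
  · rintro ⟨q, ⟨n, hn, rfl⟩, h⟩
    exact ⟨n, hn, h⟩
  · rintro ⟨n, hn, h⟩
    exact ⟨n, ⟨n, hn, rfl⟩, h⟩

/-- `‖𝟙_{C_k(N)} F_N 𝟙_{C_k(N)}‖² ≤ α C G^k`. -/
theorem stmt15 :
    ∃ C : ℝ, 0 < C ∧ ∀ M k : ℕ, 2 ≤ M → 1 ≤ k → ∀ A : Finset ℕ, A ⊆ Finset.range M →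
      A.Nonempty → ∀ α : ℚ, 1 ≤ α → α < (M : ℚ) → ∀ N : ℕ, (N : ℚ) = α * (M : ℚ) ^ k →
      opNorm (indicatorMatrix N (cantorCdil M k A α) * dftMatrix N *
          indicatorMatrix N (cantorCdil M k A α)) ^ 2 ≤
        (α : ℝ) * C * Gquant M A α ^ k := by
  refine ⟨(Real.exp (2 * Real.pi) ^ 3) ^ 2, by positivity, ?_⟩
  intro M k hM hk A hA hne α hα hαM N hN
  have hαR : (1 : ℝ) ≤ (α : ℝ) := by exact_mod_cast hα
  have hNR : (N : ℝ) = α * (M : ℝ) ^ k := by exact_mod_cast congrArg (Rat.cast : ℚ → ℝ) hN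
  have hM0 : (0 : ℝ) < M := by
    have : 0 < M := by omega
    exact_mod_cast this
  have hNpos : (0 : ℝ) < N := by rw [hNR]; positivity
  have hN1 : (1 : ℝ) ≤ N := by
    have : 0 < N := by exact_mod_cast hNpos
    exact_mod_cast this
  let ι := Fin k → A
  let r : ι → ℕ := fun a => (⌈α * (dval M a : ℚ)⌉).toNat
  let j : ι → ℝ := fun a => dval M a
  let θ : ι → ℝ := fun a => (r a : ℝ) - α * j a
  have hrc : ∀ a, ((r a : ℕ) : ℚ) = ((⌈α * (dval M a : ℚ)⌉ : ℤ) : ℚ) := by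
    intro a
    have h0 : 0 ≤ ⌈α * (dval M a : ℚ)⌉ := Int.ceil_nonneg (by positivity)
    have : ((r a : ℕ) : ℤ) = ⌈α * (dval M a : ℚ)⌉ := Int.toNat_of_nonneg h0
    exact_mod_cast congrArg (Int.cast : ℤ → ℚ) this
  have hr1 : ∀ a, α * (dval M a : ℚ) ≤ r a := fun a => by rw [hrc]; exact Int.le_ceil _
  have hr2 : ∀ a, (r a : ℚ) < α * (dval M a : ℚ) + 1 := fun a => by
    rw [hrc]; exact Int.ceil_lt_add_one _
  have hθ0 : ∀ a, 0 ≤ θ a := fun a => by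
    have : (α : ℝ) * (dval M a : ℝ) ≤ r a := by exact_mod_cast hr1 a
    simp only [θ, j]; linarith
  have hθ1 : ∀ a, θ a ≤ 1 := fun a => by
    have : (r a : ℝ) < (α : ℝ) * (dval M a : ℝ) + 1 := by exact_mod_cast hr2 a
    simp only [θ, j]; linarith
  have hrN : ∀ a, r a < N := by
    intro a
    have h1 : (dval M a : ℚ) + 1 ≤ (M : ℚ) ^ k := by exact_mod_cast dval_lt hM hA a
    have h2 : (r a : ℚ) < N := by
      rw [hN]
      have := hr2 a
      nlinarith
    exact_mod_cast h2
  have hrinj : Function.Injective r := by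
    have hlt : ∀ a b, dval M a < dval M b → r a < r b := by
      intro a b h
      have h1 : (dval M a : ℚ) + 1 ≤ dval M b := by exact_mod_cast h
      have h2 : (r a : ℚ) < r b := by
        have := hr2 a
        have := hr1 b
        nlinarith
      exact_mod_cast h2
    intro a b h
    apply dval_inj hA
    rcases lt_trichotomy (dval M a) (dval M b) with h1 | h1 | h1
    · have := hlt _ _ h1; omega
    · exact h1
    · have := hlt _ _ h1; omega
  let f : ι → Fin N := fun a => ⟨r a, hrN a⟩
  have hf : Function.Injective f := fun a b h => hrinj (congrArg Fin.val h)
  have hS : ∀ x : Fin N, (x : ℕ) ∈ cantorCdil M k A α ↔ ∃ i, f i = x := by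
    intro x
    rw [mem_cantorCdil]
    simp only [cantorC, Finset.mem_image, Fintype.mem_piFinset]
    constructor
    · rintro ⟨_, ⟨a, ha, rfl⟩, hx⟩
      refine ⟨fun i => ⟨a i, ha i⟩, Fin.ext ?_⟩
      rw [← hx]
      rfl
    · rintro ⟨a, rfl⟩
      exact ⟨_, ⟨fun i => a i, fun i => (a i).2, rfl⟩, rfl⟩
  have hcomp := opNorm_compress f hf _ hS (dftMatrix N)
  have hjM : ∀ a, |j a / (M : ℝ) ^ k| ≤ 1 := by
    intro a
    have h1 : (dval M a : ℝ) ≤ (M : ℝ) ^ k := by exact_mod_cast (dval_lt hM hA a).le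
    rw [abs_of_nonneg (by positivity)]
    exact div_le_one_of_le₀ h1 (by positivity)
  have hθa : ∀ a, |θ a| ≤ 1 := fun a => by rw [abs_of_nonneg (hθ0 a)]; exact hθ1 a
  have hθN : ∀ a, |θ a / N| ≤ 1 := fun a => by
    rw [abs_of_nonneg (div_nonneg (hθ0 a) hNpos.le)]
    exact div_le_one_of_le₀ ((hθ1 a).trans hN1) hNpos.le
  let K0 := Kmat M k A α
  let K1 : Matrix ι ι ℂ := Matrix.of fun a b => K0 a b * ec (θ a * (j b / (M : ℝ) ^ k))
  let K2 : Matrix ι ι ℂ := Matrix.of fun a b => K1 a b * ec ((j a / (M : ℝ) ^ k) * θ b)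
  let K3 : Matrix ι ι ℂ := Matrix.of fun a b => K2 a b * ec ((θ a / N) * θ b)
  have n1 : ‖K1‖ ≤ Real.exp (2 * Real.pi) * ‖K0‖ := norm_phase K0 _ _ hθa hjM
  have n2 : ‖K2‖ ≤ Real.exp (2 * Real.pi) * ‖K1‖ := norm_phase K1 _ _ hjM hθa
  have n3 : ‖K3‖ ≤ Real.exp (2 * Real.pi) * ‖K2‖ := norm_phase K2 _ _ hθN hθa
  have hK : (dftMatrix N).submatrix f f = (((Real.sqrt N)⁻¹ : ℝ) : ℂ) • K3 := by
    ext a b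
    simp only [Matrix.submatrix_apply, dftMatrix, Matrix.of_apply, Matrix.smul_apply, smul_eq_mul,
      K3, K2, K1, K0, Kmat, ← ec_add]
    congr 2
    have ha : ((f a : ℕ) : ℝ) = α * j a + θ a := by simp [θ, f]
    have hb : ((f b : ℕ) : ℝ) = α * j b + θ b := by simp [θ, f]
    have hα0 : (α : ℝ) ≠ 0 := by positivity
    rw [ha, hb, hNR]
    simp only [← show j a = (dval M a : ℝ) from rfl, ← show j b = (dval M b : ℝ) from rfl]
    field_simp
    ring
  have hE := Real.exp_pos (2 * Real.pi)
  have n4 : ‖K3‖ ≤ Real.exp (2 * Real.pi) ^ 3 * ‖K0‖ := by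
    calc _ ≤ _ := n3
      _ ≤ Real.exp (2 * Real.pi) * (Real.exp (2 * Real.pi) * (Real.exp (2 * Real.pi) * ‖K0‖)) := by
        gcongr
        exact n2.trans (by gcongr)
      _ = _ := by ring
  have hG : 0 ≤ Gquant M A α := by
    rw [Gquant_eq]; exact mul_nonneg (by positivity) (Ssup_nonneg _ _ _)
  have hnn : 0 ≤ opNorm (indicatorMatrix N (cantorCdil M k A α) * dftMatrix N *
          indicatorMatrix N (cantorCdil M k A α)) := norm_nonneg _
  have hsub : ‖(dftMatrix N).submatrix f f‖ = (Real.sqrt N)⁻¹ * ‖K3‖ := by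
    rw [hK, norm_smul, Complex.norm_real, Real.norm_of_nonneg (by positivity)]
  have hfin : (N : ℝ)⁻¹ * ((A.card : ℝ) ^ k * Ssup M A α ^ k) = (α : ℝ)⁻¹ * Gquant M A α ^ k := by
    rw [Gquant_eq, hNR]
    have hα0 : (α : ℝ) ≠ 0 := by positivity
    rw [mul_pow, div_pow]
    field_simp
  calc _ ≤ ((Real.sqrt N)⁻¹ * (Real.exp (2 * Real.pi) ^ 3 * ‖K0‖)) ^ 2 := by
        refine pow_le_pow_left₀ hnn (hcomp.trans ?_) 2
        rw [hsub]
        gcongr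
    _ = (Real.exp (2 * Real.pi) ^ 3) ^ 2 * ((N : ℝ)⁻¹ * ‖K0‖ ^ 2) := by
        rw [mul_pow, inv_pow, Real.sq_sqrt hNpos.le]; ring
    _ ≤ (Real.exp (2 * Real.pi) ^ 3) ^ 2 *
          ((N : ℝ)⁻¹ * ((A.card : ℝ) ^ k * Ssup M A α ^ k)) := by
        gcongr
        exact norm_Kmat hM k hA hne hα
    _ = (α : ℝ)⁻¹ * ((Real.exp (2 * Real.pi) ^ 3) ^ 2 * Gquant M A α ^ k) := by
        rw [hfin]; ring
    _ ≤ α * ((Real.exp (2 * Real.pi) ^ 3) ^ 2 * Gquant M A α ^ k) := by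
        refine mul_le_mul_of_nonneg_right ?_ (by positivity)
        exact (inv_le_one_of_one_le₀ hαR).trans hαR
    _ = _ := by ring

end
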